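/- arXiv:1211.4066 — 2 statements merged into one kernel-verified Lean document; each statement's English description precedes it below -/
import Mathlib

section
/- (Continuous-time case of Theorem 4.4: uniqueness under a right-handed matrix Lipschitz condition.) Let n ≥ 1, let a ≤ b be real numbers, let S be a set of symmetric real n×n matrices, and let F : ℝ → Matrix n n ℝ → Matrix n n ℝ be such that F(t,P) is symmetric for every t ∈ [a,b] and every P ∈ S. Let C : ℝ → Matrix n n ℝ be continuous on [a,b] with C(t) symmetric positive definite for every t ∈ [a,b], and assume the commutation conditions: C(s)·C(t) = C(t)·C(s) for all s,t ∈ [a,b]; C(s)·P = P·C(s) for all s ∈ [a,b] and P ∈ S; and C(s)·F(t,Q) = F(t,Q)·C(s) for all s,t ∈ [a,b] and Q ∈ S. Assume the right-handed Lipschitz condition: for all t ∈ [a,b] and all P, Q ∈ S with P − Q positive semidefinite, the matrix (P − Q)·C(t) − (F(t,P) − F(t,Q)) is positive semidefinite. Then if X, Y : ℝ → Matrix n n ℝ are differentiable on [a,b] with X′(t) = F(t, X(t)) and Y′(t) = F(t, Y(t)) for all t ∈ [a,b], X(t) ∈ S and Y(t) ∈ S and X(t) − Y(t) positive semidefinite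 for all t ∈ [a,b], and X(a) = Y(a), then X(t) = Y(t) for all t ∈ [a,b]. -/
open Matrix Set

theorem aux_entry {n : ℕ} (D : Matrix (Fin n) (Fin n) ℝ) (hD : D.PosSemidef) (i j : Fin n) :
    |D i j| ≤ D.trace := by
  have hd : ∀ k, 0 ≤ D k k := fun k => hD.diag_nonneg
  have hle : ∀ k, D k k ≤ D.trace := fun k =>
    Finset.single_le_sum (f := fun k => D k k) (fun k _ => hd k) (Finset.mem_univ k)
  have hsym : D j i = D i j := by simpa using hD.isHermitian.apply i j
  have key : ∀ s : ℝ, 0 ≤ D i i + s * D i j + s * D j i + s * s * D j j := by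
    intro s
    have := hD.dotProduct_mulVec_nonneg (Pi.single i 1 + s • Pi.single j 1)
    simp [Matrix.mulVec_add, Matrix.mulVec_smul, add_dotProduct, dotProduct_add] at this
    linarith
  have h1 := key 1
  have h2 := key (-1)
  have := hle i
  have := hle j
  rw [abs_le]
  constructor <;> linarith

/-- Continuous-time case of Theorem 4.4: uniqueness for `X' = F(t, X)` under a
right-handed matrix Lipschitz condition with positive definite Lipschitz "constant" `C`. -/
theorem stmt_1 (n : ℕ) (hn : 1 ≤ n) (a b : ℝ) (hab : a ≤ b)
    (S : Set (Matrix (Fin n) (Fin n) ℝ))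
    (hS : ∀ P ∈ S, P.IsSymm)
    (F : ℝ → Matrix (Fin n) (Fin n) ℝ → Matrix (Fin n) (Fin n) ℝ)
    (hFsymm : ∀ t ∈ Icc a b, ∀ P ∈ S, (F t P).IsSymm)
    (C : ℝ → Matrix (Fin n) (Fin n) ℝ)
    (hCcont : ContinuousOn C (Icc a b))
    (hCpd : ∀ t ∈ Icc a b, (C t).PosDef)
    (hCC : ∀ s ∈ Icc a b, ∀ t ∈ Icc a b, C s * C t = C t * C s)
    (hCS : ∀ s ∈ Icc a b, ∀ P ∈ S, C s * P = P * C s)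
    (hCF : ∀ s ∈ Icc a b, ∀ t ∈ Icc a b, ∀ Q ∈ S, C s * F t Q = F t Q * C s)
    (hLip : ∀ t ∈ Icc a b, ∀ P ∈ S, ∀ Q ∈ S, (P - Q).PosSemidef →
      ((P - Q) * C t - (F t P - F t Q)).PosSemidef)
    (X Y : ℝ → Matrix (Fin n) (Fin n) ℝ)
    (hX : ∀ t ∈ Icc a b, ∀ i j, HasDerivAt (fun s => X s i j) (F t (X t) i j) t)
    (hY : ∀ t ∈ Icc a b, ∀ i j, HasDerivAt (fun s => Y s i j) (F t (Y t) i j) t)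
    (hXS : ∀ t ∈ Icc a b, X t ∈ S)
    (hYS : ∀ t ∈ Icc a b, Y t ∈ S)
    (hXY : ∀ t ∈ Icc a b, (X t - Y t).PosSemidef)
    (hinit : X a = Y a) :
    ∀ t ∈ Icc a b, X t = Y t := by
  obtain ⟨K, hK⟩ : ∃ K : ℝ, ∀ t ∈ Icc a b, ∑ i, ∑ j, |C t j i| ≤ K := by
    have hc : ContinuousOn (fun t => ∑ i, ∑ j, |C t j i|) (Icc a b) := by
      refine continuousOn_finset_sum _ fun i _ => continuousOn_finset_sum _ fun j _ => ?_
      exact (continuousOn_pi.1 (continuousOn_pi.1 hCcont j) i).abs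
    obtain ⟨K, hK⟩ := isCompact_Icc.bddAbove_image hc
    exact ⟨K, fun t ht => hK ⟨t, ht, rfl⟩⟩
  have hu : ∀ t ∈ Icc a b, HasDerivAt (fun s => (X s - Y s).trace)
      (F t (X t) - F t (Y t)).trace t := by
    intro t ht
    simp only [Matrix.trace, Matrix.diag_apply, Matrix.sub_apply]
    exact HasDerivAt.fun_sum fun i _ => (hX t ht i i).sub (hY t ht i i)
  have hb : ∀ t ∈ Icc a b, (F t (X t) - F t (Y t)).trace ≤ K * (X t - Y t).trace := by
    intro t ht
    have h1 := (hLip t ht _ (hXS t ht) _ (hYS t ht) (hXY t ht)).trace_nonneg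
    rw [Matrix.trace_sub] at h1
    have h0 := (hXY t ht).trace_nonneg
    have h2 : ((X t - Y t) * C t).trace ≤ (∑ i, ∑ j, |C t j i|) * (X t - Y t).trace := by
      simp only [Matrix.trace, Matrix.diag_apply, Matrix.mul_apply]
      rw [Finset.sum_mul]
      refine Finset.sum_le_sum fun i _ => ?_
      rw [Finset.sum_mul]
      refine Finset.sum_le_sum fun j _ => ?_
      refine (le_abs_self _).trans ?_
      rw [abs_mul, mul_comm]
      exact mul_le_mul_of_nonneg_left (aux_entry _ (hXY t ht) i j) (abs_nonneg _)
    have h3 := mul_le_mul_of_nonneg_right (hK t ht) h0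
    linarith
  have hv : ∀ t ∈ Icc a b, HasDerivAt (fun s => (X s - Y s).trace * Real.exp (-K * s))
      ((F t (X t) - F t (Y t)).trace * Real.exp (-K * t) +
        (X t - Y t).trace * (Real.exp (-K * t) * (-K * 1))) t := by
    intro t ht
    exact (hu t ht).mul (((hasDerivAt_id t).const_mul (-K)).exp)
  have hanti : AntitoneOn (fun s => (X s - Y s).trace * Real.exp (-K * s)) (Icc a b) := by
    refine antitoneOn_of_hasDerivWithinAt_nonpos (convex_Icc a b)
      (fun t ht => (hv t ht).continuousAt.continuousWithinAt)
      (fun t ht => (hv t (interior_subset ht)).hasDerivWithinAt) fun t ht => ?_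
    have h1 := hb t (interior_subset ht)
    have h2 := mul_le_mul_of_nonneg_right h1 (Real.exp_pos (-K * t)).le
    linarith
  intro t ht
  have h := hanti (left_mem_Icc.2 hab) ht ht.1
  simp only [hinit, sub_self, Matrix.trace_zero, zero_mul] at h
  have h1 : (X t - Y t).trace ≤ 0 := nonpos_of_mul_nonpos_left h (Real.exp_pos _)
  have h2 := (hXY t ht).trace_nonneg
  exact sub_eq_zero.1 ((hXY t ht).trace_eq_zero_iff.1 (le_antisymm h1 h2))
end

section
/- (Discrete case T = ℤ of Theorem 4.11: right-handed version of uniqueness for the implicit difference equation.) Let n ≥ 1, let a ≤ b be natural numbers, let S be a set of symmetric real n×n matrices, and let F : ℕ → Matrix n n ℝ → Matrix n n ℝ be such that F(t,P) is symmetric for every t and every P ∈ S. Let C : ℕ → Matrix n n ℝ be such that C(t) is symmetric positive definite for every t with a ≤ t < b, C(s)·C(t) = C(t)·C(s) for all such s,t, and C(t)·P = P·C(t) for all such t and all P ∈ S. Assume: for all t with a ≤ t < b and all P, Q ∈ S with P − Q positive semidefinite, the matrix (P − Q)·C(t)·(I + C(t))⁻¹ − (F(t,P) − F(t,Q)) is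 positive semidefinite. Then if X, Y : ℕ → Matrix n n ℝ satisfy X(t+1) − X(t) = F(t, X(t+1)) and Y(t+1) − Y(t) = F(t, Y(t+1)) for all a ≤ t < b, with X(t) ∈ S, Y(t) ∈ S and X(t) − Y(t) positive semidefinite for all a ≤ t ≤ b, and X(a) = Y(a), then X(t) = Y(t) for all a ≤ t ≤ b. -/
open Matrix

open scoped MatrixOrder in
theorem aux_step {n : ℕ} (D C : Matrix (Fin n) (Fin n) ℝ) (hD : D.PosSemidef) (hC : C.PosDef)
    (hL : (D * (C * (1 + C)⁻¹) - D).PosSemidef) : D = 0 := by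
  have hpd : (1 + C).PosDef := Matrix.PosDef.one.add hC
  have hu : IsUnit (1 + C).det := (Matrix.isUnit_iff_isUnit_det _).mp hpd.isUnit
  set M := D * (C * (1 + C)⁻¹) - D with hM
  have hMD : D = -(M + M * C) := by
    have h : M * (1 + C) = -D := by
      rw [hM, sub_mul, mul_assoc, mul_assoc, Matrix.nonsing_inv_mul _ hu, mul_one, mul_add, mul_one]
      abel
    rw [mul_add, mul_one] at h
    rw [h, neg_neg]
  have hMC : 0 ≤ (M * C).trace := by
    obtain ⟨B, hB⟩ := CStarAlgebra.nonneg_iff_eq_star_mul_self.mp hL.nonneg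
    rw [hB, mul_assoc, Matrix.trace_mul_comm, star_eq_conjTranspose]
    exact (hC.posSemidef.mul_mul_conjTranspose_same B).trace_nonneg
  have h0 : D.trace = -(M.trace + (M * C).trace) := by
    conv_lhs => rw [hMD]
    rw [Matrix.trace_neg, Matrix.trace_add]
  have h1 := hL.trace_nonneg
  have h2 := hD.trace_nonneg
  exact hD.trace_eq_zero_iff.mp (by linarith)

/-- Discrete case `T = ℤ` of Theorem 4.11: uniqueness for the implicit difference
equation `X(t+1) - X(t) = F(t, X(t+1))` under the modified right-handed Lipschitz
condition with bound `C(t) * (I + C(t))⁻¹`. -/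
theorem stmt_3 (n : ℕ) (hn : 1 ≤ n) (a b : ℕ) (hab : a ≤ b)
    (S : Set (Matrix (Fin n) (Fin n) ℝ))
    (hS : ∀ P ∈ S, P.IsSymm)
    (F : ℕ → Matrix (Fin n) (Fin n) ℝ → Matrix (Fin n) (Fin n) ℝ)
    (hFsymm : ∀ t, ∀ P ∈ S, (F t P).IsSymm)
    (C : ℕ → Matrix (Fin n) (Fin n) ℝ)
    (hCpd : ∀ t, a ≤ t → t < b → (C t).PosDef)
    (hCC : ∀ s t, a ≤ s → s < b → a ≤ t → t < b → C s * C t = C t * C s)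
    (hCS : ∀ t, a ≤ t → t < b → ∀ P ∈ S, C t * P = P * C t)
    (hLip : ∀ t, a ≤ t → t < b → ∀ P ∈ S, ∀ Q ∈ S, (P - Q).PosSemidef →
      ((P - Q) * (C t * (1 + C t)⁻¹) - (F t P - F t Q)).PosSemidef)
    (X Y : ℕ → Matrix (Fin n) (Fin n) ℝ)
    (hX : ∀ t, a ≤ t → t < b → X (t + 1) - X t = F t (X (t + 1)))
    (hY : ∀ t, a ≤ t → t < b → Y (t + 1) - Y t = F t (Y (t + 1)))
    (hXS : ∀ t, a ≤ t → t ≤ b → X t ∈ S)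
    (hYS : ∀ t, a ≤ t → t ≤ b → Y t ∈ S)
    (hXY : ∀ t, a ≤ t → t ≤ b → (X t - Y t).PosSemidef)
    (hinit : X a = Y a) :
    ∀ t, a ≤ t → t ≤ b → X t = Y t := by
  intro t hat
  induction t, hat using Nat.le_induction with
  | base => intro _; exact hinit
  | succ t hat ih =>
    intro htb
    have ht : t < b := htb
    have hprev : X t = Y t := ih ht.le
    have h1 := hX t hat ht
    have h2 := hY t hat ht
    have hD := hXY (t+1) (by omega) htb
    have hL := hLip t hat ht _ (hXS (t+1) (by omega) htb) _ (hYS (t+1) (by omega) htb) hD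
    have hF : F t (X (t+1)) - F t (Y (t+1)) = X (t+1) - Y (t+1) := by
      rw [← h1, ← h2, hprev]; abel
    rw [hF] at hL
    have hC := hCpd t hat ht
    exact sub_eq_zero.mp (aux_step _ _ hD hC hL)
end
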